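/- The partial order ⪯ is compatible with the operation ⊕ on S^lay: for every r ∈ S^lay, the maps q ↦ q ⊕ r and q ↦ r ⊕ q are non-decreasing, i.e., q ⪯ q' implies q ⊕ r ⪯ q' ⊕ r and r ⊕ q ⪯ r ⊕ q'. Consequently (S^lay, ⊕, ⪯) is a lattice ordered monoid. -/

import Mathlib

open scoped NNReal Classical

/-- The set `S^lay = Stay ∪ Change ∪ {infeasible}`. -/
inductive Slay : Type where
  | st : ℝ≥0 → Slay
  | ch : ℝ≥0 → ℝ≥0 → Slay
  | infeasible : Slay

namespace Slay

/-- The binary operation `⊕` on `S^lay`, with minimum layer duration `τ`. -/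
noncomputable def op (τ : ℝ) : Slay → Slay → Slay
  | st a, st b => st (a + b)
  | st a, ch x y => ch (a + x) y
  | ch x y, st a => ch x (y + a)
  | ch x y, ch u v => if (y : ℝ) + (u : ℝ) < τ then infeasible else ch x v
  | infeasible, _ => infeasible
  | _, infeasible => infeasible

/-- The partial order `⪯` on `S^lay`. -/
def le : Slay → Slay → Prop
  | _, infeasible => True
  | st a, st b => b ≤ a
  | st a, ch x y => x ≤ a ∧ y ≤ a
  | ch _ _, st _ => False
  | ch x y, ch u v => u ≤ x ∧ v ≤ y
  | infeasible, _ => False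

theorem op_assoc (τ : ℝ) (q q' q'' : Slay) :
    op τ (op τ q q') q'' = op τ q (op τ q' q'') := by
  cases q <;> cases q' <;> cases q'' <;> simp only [op] <;>
    grind [op, NNReal.coe_add, add_assoc]

theorem op_mono_left (τ : ℝ) {q q' : Slay} (r : Slay) (h : le q q') :
    le (op τ q r) (op τ q' r) := by
  cases r <;> cases q <;> cases q' <;> simp only [op] <;> (try split_ifs) <;>
    simp only [le, ← NNReal.coe_le_coe, NNReal.coe_add] at h ⊢ <;> grind [NNReal.coe_nonneg]

theorem op_mono_right (τ : ℝ) {q q' : Slay} (r : Slay) (h : le q q') :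
    le (op τ r q) (op τ r q') := by
  cases r <;> cases q <;> cases q' <;> simp only [op] <;> (try split_ifs) <;>
    simp only [le, ← NNReal.coe_le_coe, NNReal.coe_add] at h ⊢ <;> grind [NNReal.coe_nonneg]

theorem st_zero_op (τ : ℝ) (q : Slay) : op τ (st 0) q = q := by
  cases q <;> simp [op]

theorem op_st_zero (τ : ℝ) (q : Slay) : op τ q (st 0) = q := by
  cases q <;> simp [op]

theorem le_refl (q : Slay) : le q q := by
  cases q <;> simp [le]

theorem le_antisymm {q q' : Slay} (h : le q q') (h' : le q' q) : q = q' := by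
  cases q <;> cases q' <;> simp only [le] at h h' <;> grind

theorem le_trans {q q' q'' : Slay} (h : le q q') (h' : le q' q'') : le q q'' := by
  cases q <;> cases q' <;> cases q'' <;> simp only [le] at h h' ⊢ <;> grind

/-- The meet of two elements of `S^lay`. -/
noncomputable def meet : Slay → Slay → Slay
  | infeasible, q => q
  | q, infeasible => q
  | st a, st b => st (max a b)
  | st a, ch x y => st (max a (max x y))
  | ch x y, st a => st (max a (max x y))
  | ch x y, ch u v => ch (max x u) (max y v)

/-- The join of two elements of `S^lay`. -/
noncomputable def join : Slay → Slay → Slay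
  | infeasible, _ => infeasible
  | _, infeasible => infeasible
  | st a, st b => st (min a b)
  | st a, ch x y => ch (min a x) (min a y)
  | ch x y, st a => ch (min a x) (min a y)
  | ch x y, ch u v => ch (min x u) (min y v)

theorem meet_le_left (q q' : Slay) : le (meet q q') q := by
  cases q <;> cases q' <;> simp [le, meet]

theorem meet_le_right (q q' : Slay) : le (meet q q') q' := by
  cases q <;> cases q' <;> simp [le, meet]

theorem le_meet {q q' r : Slay} (h : le r q) (h' : le r q') : le r (meet q q') := by
  cases q <;> cases q' <;> cases r <;> simp only [le, meet] at h h' ⊢ <;> grind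

theorem le_join_left (q q' : Slay) : le q (join q q') := by
  cases q <;> cases q' <;> simp [le, join]

theorem le_join_right (q q' : Slay) : le q' (join q q') := by
  cases q <;> cases q' <;> simp [le, join]

theorem join_le {q q' r : Slay} (h : le q r) (h' : le q' r) : le (join q q') r := by
  cases q <;> cases q' <;> cases r <;> simp only [le, join] at h h' ⊢ <;> grind

/-- The partial order `⪯` is compatible with `⊕`: for every `r`, the maps `q ↦ q ⊕ r` and
`q ↦ r ⊕ q` are non-decreasing. Consequently `(S^lay, ⊕, ⪯)` is a lattice ordered monoid:
`⊕` is associative with neutral element `st 0`, `⪯` is a partial order in which any two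
elements have a meet and a join, and `⪯` is compatible with `⊕`. -/
theorem latticeOrderedMonoid (τ : ℝ) (hτ : 0 ≤ τ) :
    (∀ r q q' : Slay, le q q' → le (op τ q r) (op τ q' r) ∧ le (op τ r q) (op τ r q')) ∧
    (∀ q q' q'' : Slay, op τ (op τ q q') q'' = op τ q (op τ q' q'')) ∧
    (∀ q : Slay, op τ (st 0) q = q ∧ op τ q (st 0) = q) ∧
    (∀ q : Slay, le q q) ∧
    (∀ q q' : Slay, le q q' → le q' q → q = q') ∧
    (∀ q q' q'' : Slay, le q q' → le q' q'' → le q q'') ∧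
    (∀ q q' : Slay, ∃ m : Slay, le m q ∧ le m q' ∧ ∀ r : Slay, le r q → le r q' → le r m) ∧
    (∀ q q' : Slay, ∃ j : Slay, le q j ∧ le q' j ∧ ∀ r : Slay, le q r → le q' r → le j r) := by
  exact ⟨fun r _ _ h => ⟨op_mono_left τ r h, op_mono_right τ r h⟩, op_assoc τ,
    fun q => ⟨st_zero_op τ q, op_st_zero τ q⟩, le_refl, fun _ _ => le_antisymm,
    fun _ _ _ => le_trans,
    fun q q' => ⟨meet q q', meet_le_left q q', meet_le_right q q', fun _ => le_meet⟩,
    fun q q' => ⟨join q q', le_join_left q q', le_join_right q q', fun _ => join_le⟩⟩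

end Slay
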